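/- arXiv:2108.07637 — 2 statements merged into one kernel-verified Lean document; each statement's English description precedes it below -/
import Mathlib

section
/- For every n ≥ 2, the lattice of lower sets (down-closed subsets, ordered by inclusion) of the poset of bigrassmannian permutations of {1,…,n} under the Bruhat order is order-isomorphic to the lattice ASM_n of n×n alternating sign matrices under the partial-sum order; the isomorphism can be chosen so that the principal lower set generated by a bigrassmannian permutation w is sent to the permutation matrix [w]. -/
namespace ASMPaper

/-- The nonzero entries of a vector (a row or a column of a matrix) alternate in sign:
any two nonzero entries with only zero entries strictly between them have opposite values. -/
def Alternating {n : ℕ} (v : Fin n → ℤ) : Prop :=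
  ∀ j₁ j₂ : Fin n, j₁ < j₂ → v j₁ ≠ 0 → v j₂ ≠ 0 →
    (∀ j, j₁ < j → j < j₂ → v j = 0) → v j₂ = - v j₁

/-- `A` is an alternating sign matrix: entries in `{-1,0,1}`, all row and column sums
equal to `1`, and the nonzero entries in each row and column alternate in sign. -/
def IsASM {n : ℕ} (A : Matrix (Fin n) (Fin n) ℤ) : Prop :=
  (∀ i j, A i j = -1 ∨ A i j = 0 ∨ A i j = 1) ∧
  (∀ i, ∑ j, A i j = 1) ∧
  (∀ j, ∑ i, A i j = 1) ∧
  (∀ i, Alternating (fun j => A i j)) ∧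
  (∀ j, Alternating (fun i => A i j))

/-- The partial sum `C(A)_{kl} = ∑_{i ≤ k, j ≤ l} A_{ij}`. -/
def Csum {n : ℕ} (A : Matrix (Fin n) (Fin n) ℤ) (k l : Fin n) : ℤ :=
  ∑ i ∈ Finset.Iic k, ∑ j ∈ Finset.Iic l, A i j

/-- The partial-sum (Bruhat) order on alternating sign matrices:
`A ≤ B` iff all partial sums of `A` are at least those of `B`. -/
def asmLe {n : ℕ} (A B : Matrix (Fin n) (Fin n) ℤ) : Prop :=
  ∀ k l, Csum B k l ≤ Csum A k l

end ASMPaper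

namespace ASMPaper

/-- The permutation matrix of `x`: `[x]_{ij} = 1` if `x j = i` and `0` otherwise. -/
def permMat {n : ℕ} (x : Equiv.Perm (Fin n)) : Matrix (Fin n) (Fin n) ℤ :=
  Matrix.of fun i j => if x j = i then 1 else 0

/-- The Bruhat order on permutations, via entrywise comparison of partial sums of
permutation matrices. -/
def bruhatLe {n : ℕ} (x y : Equiv.Perm (Fin n)) : Prop :=
  ∀ k l, Csum (permMat y) k l ≤ Csum (permMat x) k l

/-- The set of descents of a permutation `w` of `Fin n`: 0-indexed positions `i` with
`i + 1 < n` and `w (i+1) < w i`. -/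
def descents {n : ℕ} (w : Equiv.Perm (Fin n)) : Finset ℕ :=
  (Finset.range (n - 1)).filter
    (fun i => ∀ h : i + 1 < n, w ⟨i + 1, h⟩ < w ⟨i, Nat.lt_of_succ_lt h⟩)

/-- A permutation is bigrassmannian if it and its inverse each have exactly one descent. -/
def Bigrassmannian {n : ℕ} (w : Equiv.Perm (Fin n)) : Prop :=
  (descents w).card = 1 ∧ (descents w⁻¹).card = 1

/-- The underlying set of the tetrahedral poset `Tetr_n`:
triples `(i, j, g(i,j,k))` with `1 ≤ i, j ≤ n-1`, `0 ≤ k ≤ d(i,j)`, where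
`d(i,j) = min{i, j, n-i, n-j} - 1` and `g(i,j,k) = (n-1)(n-2)/2 - |i-j| - 2k`. -/
def TetrSet (n : ℕ) : Set (ℤ × ℤ × ℤ) :=
  {p | ∃ i j k : ℤ, 1 ≤ i ∧ i ≤ (n : ℤ) - 1 ∧ 1 ≤ j ∧ j ≤ (n : ℤ) - 1 ∧
    0 ≤ k ∧ k ≤ min (min i j) (min ((n : ℤ) - i) ((n : ℤ) - j)) - 1 ∧
    p = (i, j, ((n : ℤ) - 1) * ((n : ℤ) - 2) / 2 - |i - j| - 2 * k)}

/-- The generating relations of the tetrahedral poset: `(i,j,g) ≤ (i±1, j, g+1)` and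
`(i,j,g) ≤ (i, j±1, g+1)`, imposed whenever both triples belong to `Tetr_n`. -/
def tetrStep (n : ℕ) (p q : ℤ × ℤ × ℤ) : Prop :=
  p ∈ TetrSet n ∧ q ∈ TetrSet n ∧ q.2.2 = p.2.2 + 1 ∧
    ((q.2.1 = p.2.1 ∧ (q.1 = p.1 + 1 ∨ q.1 = p.1 - 1)) ∨
     (q.1 = p.1 ∧ (q.2.1 = p.2.1 + 1 ∨ q.2.1 = p.2.1 - 1)))

/-- The order of the tetrahedral poset: the reflexive-transitive closure of the
generating relations. -/
def tetrLe (n : ℕ) : ℤ × ℤ × ℤ → ℤ × ℤ × ℤ → Prop :=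
  Relation.ReflTransGen (tetrStep n)

end ASMPaper

namespace ASMPaper

/-- `U` is a lower set (down-closed subset) of the poset of bigrassmannian permutations
of `{1, …, n}` under the Bruhat order. -/
def IsLowerSetBG (n : ℕ) (U : Set (Equiv.Perm (Fin n))) : Prop :=
  (∀ w ∈ U, Bigrassmannian w) ∧
  ∀ x y : Equiv.Perm (Fin n), Bigrassmannian x → y ∈ U → bruhatLe x y → x ∈ U

end ASMPaper

namespace ASMPaper

open Finset

/-- Extension of a vector by zero. -/
def zeroExt {n : ℕ} (v : Fin n → ℤ) (j : ℕ) : ℤ := if h : j < n then v ⟨j, h⟩ else 0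

/-- Extension of a matrix by zero. -/
def matExt {n : ℕ} (A : Matrix (Fin n) (Fin n) ℤ) (i j : ℕ) : ℤ :=
  if h : i < n ∧ j < n then A ⟨i, h.1⟩ ⟨j, h.2⟩ else 0

/-- The sum of the entries of `A` in the first `k` rows and the first `l` columns. -/
def cornerSum {n : ℕ} (A : Matrix (Fin n) (Fin n) ℤ) (k l : ℕ) : ℤ :=
  ∑ i ∈ range k, ∑ j ∈ range l, matExt A i j

/-- `c` is a corner sum matrix of size `n`. -/
structure IsCorner (n : ℕ) (c : ℕ → ℕ → ℤ) : Prop where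
  zero_left : ∀ l ≤ n, c 0 l = 0
  zero_right : ∀ k ≤ n, c k 0 = 0
  top_left : ∀ l ≤ n, c n l = l
  top_right : ∀ k ≤ n, c k n = k
  mono_left : ∀ k < n, ∀ l ≤ n, c k l ≤ c (k + 1) l
  succ_left : ∀ k < n, ∀ l ≤ n, c (k + 1) l ≤ c k l + 1
  mono_right : ∀ k ≤ n, ∀ l < n, c k l ≤ c k (l + 1)
  succ_right : ∀ k ≤ n, ∀ l < n, c k (l + 1) ≤ c k l + 1

theorem IsCorner.swap {n : ℕ} {c : ℕ → ℕ → ℤ} (h : IsCorner n c) :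
    IsCorner n fun k l => c l k where
  zero_left := h.zero_right
  zero_right := h.zero_left
  top_left := h.top_right
  top_right := h.top_left
  mono_left k hk l hl := h.mono_right l hl k hk
  succ_left k hk l hl := h.succ_right l hl k hk
  mono_right k hk l hl := h.mono_left l hl k hk
  succ_right k hk l hl := h.succ_left l hl k hk

theorem IsCorner.nonneg {n : ℕ} {c : ℕ → ℕ → ℤ} (h : IsCorner n c) {k l : ℕ}
    (hk : k ≤ n) (hl : l ≤ n) : 0 ≤ c k l := by
  induction l with
  | zero => rw [h.zero_right k hk]
  | succ l ih => exact (ih (by omega)).trans (h.mono_right k hk l hl)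

theorem IsCorner.le_right {n : ℕ} {c : ℕ → ℕ → ℤ} (h : IsCorner n c) {k l : ℕ}
    (hk : k ≤ n) (hl : l ≤ n) : c k l ≤ l := by
  induction l with
  | zero => simp [h.zero_right k hk]
  | succ l ih =>
    have h1 := ih (by omega)
    have h2 := h.succ_right k hk l hl
    push_cast
    omega

theorem IsCorner.le_left {n : ℕ} {c : ℕ → ℕ → ℤ} (h : IsCorner n c) {k l : ℕ}
    (hk : k ≤ n) (hl : l ≤ n) : c k l ≤ k :=
  h.swap.le_right hl hk

theorem IsCorner.add_le {n : ℕ} {c : ℕ → ℕ → ℤ} (h : IsCorner n c) {k l : ℕ}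
    (hk : k ≤ n) (hl : l ≤ n) : (k : ℤ) + l ≤ c k l + n := by
  induction hl using Nat.decreasingInduction with
  | self => rw [h.top_right k hk]
  | of_succ l hl ih =>
    have h2 := h.succ_right k hk l hl
    push_cast at ih
    omega

theorem IsCorner.inf' {n : ℕ} {ι : Type*} {s : Finset ι} (hs : s.Nonempty)
    {c : ι → ℕ → ℕ → ℤ} (h : ∀ x ∈ s, IsCorner n (c x)) :
    IsCorner n fun k l => s.inf' hs fun x => c x k l := by
  have key : ∀ k l k' l' : ℕ, ∀ a : ℤ, (∀ x ∈ s, c x k l ≤ c x k' l' + a) →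
      (s.inf' hs fun x => c x k l) ≤ (s.inf' hs fun x => c x k' l') + a := by
    intro k l k' l' a H
    obtain ⟨x, hx, hx'⟩ := s.exists_mem_eq_inf' hs fun x => c x k' l'
    rw [hx']
    exact (Finset.inf'_le _ hx).trans (H x hx)
  have const : ∀ k l : ℕ, ∀ a : ℤ, (∀ x ∈ s, c x k l = a) →
      (s.inf' hs fun x => c x k l) = a := by
    intro k l a H
    obtain ⟨x, hx, hx'⟩ := s.exists_mem_eq_inf' hs fun x => c x k l
    rw [hx', H x hx]
  exact
    { zero_left := fun l hl => const _ _ _ fun x hx => (h x hx).zero_left l hl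
      zero_right := fun k hk => const _ _ _ fun x hx => (h x hx).zero_right k hk
      top_left := fun l hl => const _ _ _ fun x hx => (h x hx).top_left l hl
      top_right := fun k hk => const _ _ _ fun x hx => (h x hx).top_right k hk
      mono_left := fun k hk l hl => by
        simpa using key k l (k + 1) l 0 fun x hx => by simpa using (h x hx).mono_left k hk l hl
      succ_left := fun k hk l hl => key _ _ _ _ 1 fun x hx => (h x hx).succ_left k hk l hl
      mono_right := fun k hk l hl => by
        simpa using key k l k (l + 1) 0 fun x hx => by simpa using (h x hx).mono_right k hk l hl
      succ_right := fun k hk l hl => key _ _ _ _ 1 fun x hx => (h x hx).succ_right k hk l hl }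

/-! ### Corner sums of matrices -/

theorem Csum_eq_cornerSum {n : ℕ} (A : Matrix (Fin n) (Fin n) ℤ) (k l : Fin n) :
    Csum A k l = cornerSum A (k + 1) (l + 1) := by
  have key : ∀ (m : Fin n) (f : ℕ → ℤ),
      ∑ i ∈ Iic m, f i = ∑ i ∈ range (m + 1), f i := by
    intro m f
    rw [Nat.range_succ_eq_Iic, ← Fin.map_valEmbedding_Iic, sum_map]
    rfl
  unfold Csum cornerSum
  rw [← key k]
  refine sum_congr rfl fun i _ => ?_
  rw [← key l]
  refine sum_congr rfl fun j _ => ?_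
  simp [matExt]

theorem matExt_transpose {n : ℕ} (A : Matrix (Fin n) (Fin n) ℤ) (i j : ℕ) :
    matExt A.transpose i j = matExt A j i := by
  simp [matExt, and_comm]

theorem cornerSum_transpose {n : ℕ} (A : Matrix (Fin n) (Fin n) ℤ) (k l : ℕ) :
    cornerSum A.transpose k l = cornerSum A l k := by
  unfold cornerSum
  rw [sum_comm]
  simp [matExt_transpose]

@[simp]
theorem cornerSum_zero_left {n : ℕ} (A : Matrix (Fin n) (Fin n) ℤ) (l : ℕ) :
    cornerSum A 0 l = 0 := by
  simp [cornerSum]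

@[simp]
theorem cornerSum_zero_right {n : ℕ} (A : Matrix (Fin n) (Fin n) ℤ) (k : ℕ) :
    cornerSum A k 0 = 0 := by
  simp [cornerSum]

theorem cornerSum_succ_left {n : ℕ} (A : Matrix (Fin n) (Fin n) ℤ) (k l : ℕ) :
    cornerSum A (k + 1) l = cornerSum A k l + ∑ j ∈ range l, matExt A k j := by
  simp [cornerSum, sum_range_succ]

theorem cornerSum_succ_right {n : ℕ} (A : Matrix (Fin n) (Fin n) ℤ) (k l : ℕ) :
    cornerSum A k (l + 1) = cornerSum A k l + ∑ i ∈ range k, matExt A i l := by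
  simp [cornerSum, sum_range_succ, sum_add_distrib]

theorem matExt_of_lt {n : ℕ} (A : Matrix (Fin n) (Fin n) ℤ) {i : ℕ} (hi : i < n) (j : ℕ) :
    matExt A i j = zeroExt (A ⟨i, hi⟩) j := by
  simp [matExt, zeroExt, hi]

theorem asmLe_iff {n : ℕ} (A B : Matrix (Fin n) (Fin n) ℤ) :
    asmLe A B ↔ ∀ k ≤ n, ∀ l ≤ n, cornerSum B k l ≤ cornerSum A k l := by
  simp only [asmLe, Csum_eq_cornerSum]
  refine ⟨fun h k hk l hl => ?_, fun h k l => h _ k.2 _ l.2⟩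
  rcases k with - | k
  · simp
  rcases l with - | l
  · simp
  exact h ⟨k, hk⟩ ⟨l, hl⟩

theorem matExt_eq_cornerSum {n : ℕ} (A : Matrix (Fin n) (Fin n) ℤ) (i j : ℕ) :
    matExt A i j = cornerSum A (i + 1) (j + 1) - cornerSum A (i + 1) j
      - cornerSum A i (j + 1) + cornerSum A i j := by
  rw [cornerSum_succ_left, cornerSum_succ_left, sum_range_succ]
  ring

theorem eq_of_cornerSum_eq {n : ℕ} {A B : Matrix (Fin n) (Fin n) ℤ}
    (h : ∀ k ≤ n, ∀ l ≤ n, cornerSum A k l = cornerSum B k l) : A = B := by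
  ext i j
  have hA := matExt_eq_cornerSum A i j
  have hB := matExt_eq_cornerSum B i j
  rw [h _ (by omega) _ (by omega), h _ (by omega) _ (by omega), h _ (by omega) _ (by omega),
    h _ (by omega) _ (by omega), ← hB] at hA
  simpa [matExt] using hA

theorem eq_of_asmLe_of_asmLe {n : ℕ} {A B : Matrix (Fin n) (Fin n) ℤ}
    (h : asmLe A B) (h' : asmLe B A) : A = B := by
  rw [asmLe_iff] at h h'
  exact eq_of_cornerSum_eq fun k hk l hl => le_antisymm (h' k hk l hl) (h k hk l hl)

/-! ### Alternating vectors and their partial sums -/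

theorem Alternating.zeroExt {n : ℕ} {v : Fin n → ℤ} (h : Alternating v) {a b : ℕ}
    (hab : a < b) (ha : zeroExt v a ≠ 0) (hb : zeroExt v b ≠ 0)
    (hz : ∀ j, a < j → j < b → ASMPaper.zeroExt v j = 0) :
    ASMPaper.zeroExt v b = - ASMPaper.zeroExt v a := by
  have hbn : b < n := by
    by_contra hbn
    exact hb (by simp [ASMPaper.zeroExt, hbn])
  have han : a < n := hab.trans hbn
  simp only [ASMPaper.zeroExt, hbn, han, dite_true] at ha hb ⊢
  refine h ⟨a, han⟩ ⟨b, hbn⟩ hab ha hb fun j h1 h2 => ?_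
  simpa [ASMPaper.zeroExt] using hz j h1 h2

theorem sum_zeroExt {n : ℕ} (v : Fin n → ℤ) : ∑ j ∈ range n, zeroExt v j = ∑ j, v j := by
  rw [← Fin.sum_univ_eq_sum_range]
  simp [zeroExt]

theorem Alternating.exists_partialSums {n : ℕ} {v : Fin n → ℤ} (h : Alternating v)
    (hv : ∀ j, v j = -1 ∨ v j = 0 ∨ v j = 1) (k : ℕ) :
    (∀ j < k, ASMPaper.zeroExt v j = 0) ∨
    ∃ e : ℤ, (e = 1 ∨ e = -1) ∧
      (∀ m ≤ k, ∑ j ∈ range m, ASMPaper.zeroExt v j = 0 ∨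
        ∑ j ∈ range m, ASMPaper.zeroExt v j = e) ∧
      ∃ a < k, (∀ j, a < j → j < k → ASMPaper.zeroExt v j = 0) ∧
        ((ASMPaper.zeroExt v a = e ∧ ∑ j ∈ range k, ASMPaper.zeroExt v j = e) ∨
         (ASMPaper.zeroExt v a = -e ∧ ∑ j ∈ range k, ASMPaper.zeroExt v j = 0)) := by
  have hv' : ∀ j, ASMPaper.zeroExt v j = -1 ∨ ASMPaper.zeroExt v j = 0 ∨
      ASMPaper.zeroExt v j = 1 := by
    intro j
    unfold ASMPaper.zeroExt
    split_ifs
    · exact hv _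
    · simp
  induction k with
  | zero => left; simp
  | succ k ih =>
    by_cases hk : ASMPaper.zeroExt v k = 0
    · rcases ih with ih | ⟨e, he, hm, a, ha, haz, hd⟩
      · left
        intro j hj
        rcases Nat.lt_succ_iff_lt_or_eq.1 hj with hj | rfl
        exacts [ih j hj, hk]
      · right
        have hsum : ∑ j ∈ range (k + 1), ASMPaper.zeroExt v j
            = ∑ j ∈ range k, ASMPaper.zeroExt v j := by rw [sum_range_succ, hk, add_zero]
        refine ⟨e, he, fun m hm' => ?_, a, by omega, fun j h1 h2 => ?_, by rwa [hsum]⟩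
        · rcases Nat.le_succ_iff.1 hm' with hm' | rfl
          · exact hm m hm'
          · rw [hsum]; exact hm k le_rfl
        · rcases Nat.lt_succ_iff_lt_or_eq.1 h2 with h2 | rfl
          exacts [haz j h1 h2, hk]
    · right
      rcases ih with ih | ⟨e, he, hm, a, ha, haz, hd⟩
      · have hz : ∀ m ≤ k, ∑ j ∈ range m, ASMPaper.zeroExt v j = 0 := fun m hm =>
          sum_eq_zero fun j hj => ih j ((mem_range.1 hj).trans_le hm)
        have hsum : ∑ j ∈ range (k + 1), ASMPaper.zeroExt v j = ASMPaper.zeroExt v k := by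
          rw [sum_range_succ, hz k le_rfl, zero_add]
        refine ⟨ASMPaper.zeroExt v k, ?_, fun m hm => ?_, k, by omega, fun j h1 h2 => by omega,
          Or.inl ⟨rfl, hsum⟩⟩
        · have := hv' k
          tauto
        · rcases Nat.le_succ_iff.1 hm with hm | rfl
          · exact Or.inl (hz m hm)
          · exact Or.inr hsum
      · have hne : ASMPaper.zeroExt v a ≠ 0 := by
          rcases he with rfl | rfl <;> rcases hd with hd | hd <;> rw [hd.1] <;> decide
        have halt := h.zeroExt ha hne hk haz
        have hs := sum_range_succ (ASMPaper.zeroExt v) k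
        have hd' : (ASMPaper.zeroExt v k = e ∧ ∑ j ∈ range (k + 1), ASMPaper.zeroExt v j = e) ∨
            (ASMPaper.zeroExt v k = -e ∧ ∑ j ∈ range (k + 1), ASMPaper.zeroExt v j = 0) := by
          omega
        refine ⟨e, he, fun m hm' => ?_, k, by omega, fun j h1 h2 => by omega, hd'⟩
        rcases Nat.le_succ_iff.1 hm' with hm' | rfl
        · exact hm m hm'
        · tauto

theorem Alternating.partialSums {n : ℕ} {v : Fin n → ℤ} (h : Alternating v)
    (hv : ∀ j, v j = -1 ∨ v j = 0 ∨ v j = 1) (hs : ∑ j, v j = 1) {k : ℕ} (hk : k ≤ n) :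
    0 ≤ ∑ j ∈ range k, ASMPaper.zeroExt v j ∧ ∑ j ∈ range k, ASMPaper.zeroExt v j ≤ 1 := by
  rw [← sum_zeroExt] at hs
  rcases h.exists_partialSums hv n with h0 | ⟨e, he, hm, -⟩
  · rw [sum_eq_zero fun j hj => h0 j (mem_range.1 hj)] at hs
    omega
  · have h1 := hm n le_rfl
    have h2 := hm k hk
    omega

theorem alternating_of_partialSums {n : ℕ} {v : Fin n → ℤ}
    (h : ∀ k ≤ n, 0 ≤ ∑ j ∈ range k, zeroExt v j ∧ ∑ j ∈ range k, zeroExt v j ≤ 1) :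
    (∀ j, v j = -1 ∨ v j = 0 ∨ v j = 1) ∧ Alternating v := by
  have hs : ∀ j : Fin n, ∑ a ∈ range (j + 1), zeroExt v a = ∑ a ∈ range j, zeroExt v a + v j := by
    intro j
    simp [sum_range_succ, zeroExt]
  refine ⟨fun j => ?_, fun a b hab ha hb hz => ?_⟩
  · have h1 := h j j.2.le
    have h2 := h (j + 1) j.2
    have h3 := hs j
    omega
  · have hconst : ∀ m, (a : ℕ) + 1 ≤ m → m ≤ b →
        ∑ j ∈ range m, zeroExt v j = ∑ j ∈ range (a + 1), zeroExt v j := by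
      intro m hm
      induction m, hm using Nat.le_induction with
      | base => intro _; rfl
      | succ m hm ih =>
        intro hmb
        have hmn : m < n := by omega
        have h0 : zeroExt v m = 0 := by
          simpa [zeroExt, hmn] using hz ⟨m, hmn⟩ (Fin.lt_def.2 (by simpa using hm))
            (Fin.lt_def.2 (by simpa using hmb))
        rw [sum_range_succ, h0, add_zero]
        exact ih (by omega)
    have h1 := hconst b hab le_rfl
    have h2 := hs a
    have h3 := hs b
    have h4 := h a a.2.le
    have h5 := h (a + 1) a.2
    have h6 := h (b + 1) b.2
    omega

/-! ### Alternating sign matrices and corner sum matrices -/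

theorem IsASM.transpose {n : ℕ} {A : Matrix (Fin n) (Fin n) ℤ} (h : IsASM A) :
    IsASM A.transpose :=
  ⟨fun i j => h.1 j i, h.2.2.1, h.2.1, h.2.2.2.2, h.2.2.2.1⟩

theorem IsASM.row_partialSums {n : ℕ} {A : Matrix (Fin n) (Fin n) ℤ} (h : IsASM A) {i l : ℕ}
    (hi : i < n) (hl : l ≤ n) :
    0 ≤ ∑ j ∈ range l, matExt A i j ∧ ∑ j ∈ range l, matExt A i j ≤ 1 := by
  simp only [matExt_of_lt A hi]
  exact (h.2.2.2.1 ⟨i, hi⟩).partialSums (h.1 _) (h.2.1 _) hl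

theorem IsASM.cornerSum_top_right {n : ℕ} {A : Matrix (Fin n) (Fin n) ℤ} (h : IsASM A) {k : ℕ}
    (hk : k ≤ n) : cornerSum A k n = k := by
  induction k with
  | zero => simp
  | succ k ih =>
    rw [cornerSum_succ_left, ih (by omega)]
    simp only [matExt_of_lt A hk]
    rw [sum_zeroExt, h.2.1]
    simp

theorem IsASM.isCorner {n : ℕ} {A : Matrix (Fin n) (Fin n) ℤ} (h : IsASM A) :
    IsCorner n (cornerSum A) := by
  have col : ∀ k ≤ n, ∀ l < n, cornerSum A k l ≤ cornerSum A k (l + 1) ∧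
      cornerSum A k (l + 1) ≤ cornerSum A k l + 1 := by
    intro k hk l hl
    have := h.transpose.row_partialSums hl hk
    simp only [matExt_transpose] at this
    rw [cornerSum_succ_right]
    omega
  have row : ∀ k < n, ∀ l ≤ n, cornerSum A k l ≤ cornerSum A (k + 1) l ∧
      cornerSum A (k + 1) l ≤ cornerSum A k l + 1 := by
    intro k hk l hl
    have := h.row_partialSums hk hl
    rw [cornerSum_succ_left]
    omega
  exact
    { zero_left := by simp
      zero_right := by simp
      top_left := fun l hl => by rw [← cornerSum_transpose, h.transpose.cornerSum_top_right hl]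
      top_right := fun k hk => h.cornerSum_top_right hk
      mono_left := fun k hk l hl => (row k hk l hl).1
      succ_left := fun k hk l hl => (row k hk l hl).2
      mono_right := fun k hk l hl => (col k hk l hl).1
      succ_right := fun k hk l hl => (col k hk l hl).2 }

theorem isASM_of_isCorner {n : ℕ} {A : Matrix (Fin n) (Fin n) ℤ}
    (h : IsCorner n (cornerSum A)) : IsASM A := by
  have half : ∀ B : Matrix (Fin n) (Fin n) ℤ, IsCorner n (cornerSum B) → ∀ i : Fin n,
      (∀ j, B i j = -1 ∨ B i j = 0 ∨ B i j = 1) ∧ Alternating (B i) ∧ ∑ j, B i j = 1 := by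
    intro B hB i
    have hrow : ∀ k, ∑ j ∈ range k, zeroExt (B i) j
        = cornerSum B (i + 1) k - cornerSum B i k := by
      intro k
      rw [cornerSum_succ_left]
      simp [matExt_of_lt B i.2]
    obtain ⟨h1, h2⟩ := alternating_of_partialSums (v := B i) fun k hk => by
      have h3 := hB.mono_left i i.2 k hk
      have h4 := hB.succ_left i i.2 k hk
      rw [hrow]
      omega
    refine ⟨h1, h2, ?_⟩
    rw [← sum_zeroExt, hrow, hB.top_right _ i.2, hB.top_right _ i.2.le]
    simp
  have hT : IsCorner n (cornerSum A.transpose) := by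
    have : cornerSum A.transpose = fun k l => cornerSum A l k := by
      ext k l
      exact cornerSum_transpose A k l
    rw [this]
    exact h.swap
  exact ⟨fun i => (half A h i).1, fun i => (half A h i).2.2, fun j => (half _ hT j).2.2,
    fun i => (half A h i).2.1, fun j => (half _ hT j).2.1⟩

theorem IsCorner.congr {n : ℕ} {c d : ℕ → ℕ → ℤ} (h : IsCorner n c)
    (hcd : ∀ k ≤ n, ∀ l ≤ n, d k l = c k l) : IsCorner n d where
  zero_left l hl := by rw [hcd _ (by omega) _ hl, h.zero_left l hl]
  zero_right k hk := by rw [hcd _ hk _ (by omega), h.zero_right k hk]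
  top_left l hl := by rw [hcd _ le_rfl _ hl, h.top_left l hl]
  top_right k hk := by rw [hcd _ hk _ le_rfl, h.top_right k hk]
  mono_left k hk l hl := by
    rw [hcd _ hk.le _ hl, hcd _ hk _ hl]; exact h.mono_left k hk l hl
  succ_left k hk l hl := by
    rw [hcd _ hk.le _ hl, hcd _ hk _ hl]; exact h.succ_left k hk l hl
  mono_right k hk l hl := by
    rw [hcd _ hk _ hl.le, hcd _ hk _ hl]; exact h.mono_right k hk l hl
  succ_right k hk l hl := by
    rw [hcd _ hk _ hl.le, hcd _ hk _ hl]; exact h.succ_right k hk l hl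

theorem IsCorner.exists_isASM {n : ℕ} {c : ℕ → ℕ → ℤ} (h : IsCorner n c) :
    ∃ A : Matrix (Fin n) (Fin n) ℤ, IsASM A ∧ ∀ k ≤ n, ∀ l ≤ n, cornerSum A k l = c k l := by
  let A : Matrix (Fin n) (Fin n) ℤ := Matrix.of fun i j =>
    c (i + 1) (j + 1) - c (i + 1) j - c i (j + 1) + c i j
  have hA : ∀ i < n, ∀ j < n,
      matExt A i j = (c (i + 1) (j + 1) - c i (j + 1)) - (c (i + 1) j - c i j) := by
    intro i hi j hj
    simp only [matExt, hi, hj, and_self, dite_true, A, Matrix.of_apply]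
    ring
  have hc : ∀ k ≤ n, ∀ l ≤ n, cornerSum A k l = c k l := by
    intro k hk l hl
    induction k with
    | zero => simp [h.zero_left l hl]
    | succ k ih =>
      rw [cornerSum_succ_left, ih (by omega), sum_congr rfl fun j hj =>
        hA k hk j ((mem_range.1 hj).trans_le hl),
        sum_range_sub (fun j => c (k + 1) j - c k j), h.zero_right _ hk,
        h.zero_right k (by omega)]
      ring
  exact ⟨A, isASM_of_isCorner (h.congr hc), hc⟩

/-! ### Permutation matrices -/

theorem permMat_inv {n : ℕ} (w : Equiv.Perm (Fin n)) : permMat w⁻¹ = (permMat w).transpose := by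
  ext i j
  simp only [permMat, Matrix.of_apply, Matrix.transpose_apply, Equiv.Perm.inv_eq_iff_eq,
    @eq_comm _ j]

theorem isASM_permMat {n : ℕ} (w : Equiv.Perm (Fin n)) : IsASM (permMat w) := by
  have col : ∀ (w : Equiv.Perm (Fin n)) j, ∑ i, permMat w i j = 1 := by
    intro w j
    simp [permMat]
  have alt : ∀ (w : Equiv.Perm (Fin n)) j, Alternating (fun i => permMat w i j) := by
    intro w j a b hab ha hb
    simp only [permMat, Matrix.of_apply, ne_eq, ite_eq_right_iff, one_ne_zero, imp_false,
      not_not] at ha hb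
    exact absurd (ha.symm.trans hb) hab.ne
  refine ⟨fun i j => ?_, fun i => ?_, col w, fun i => ?_, alt w⟩
  · simp only [permMat, Matrix.of_apply]
    split_ifs <;> simp
  · simpa [permMat_inv] using col w⁻¹ i
  · simpa [permMat_inv] using alt w⁻¹ i

theorem permMat_injective {n : ℕ} :
    Function.Injective (permMat : Equiv.Perm (Fin n) → Matrix (Fin n) (Fin n) ℤ) := by
  intro w x h
  ext j
  have := congrFun (congrFun h (w j)) j
  simp only [permMat, Matrix.of_apply, if_true] at this
  by_contra hne
  rw [if_neg fun h' => hne (by rw [h'])] at this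
  exact one_ne_zero this

theorem cornerSum_permMat_succ_right {n : ℕ} (w : Equiv.Perm (Fin n)) {k l : ℕ}
    (hl : l < n) :
    cornerSum (permMat w) k (l + 1) =
      cornerSum (permMat w) k l + if (w ⟨l, hl⟩ : ℕ) < k then 1 else 0 := by
  rw [cornerSum_succ_right]
  congr 1
  have : ∀ i, matExt (permMat w) i l = if (w ⟨l, hl⟩ : ℕ) = i then 1 else 0 := by
    intro i
    by_cases hi : i < n
    · simp [matExt, hi, hl, permMat, Fin.ext_iff]
    · have : (w ⟨l, hl⟩ : ℕ) ≠ i := by have := (w ⟨l, hl⟩).2; omega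
      simp [matExt, hi, this]
  simp [this]

/-- The permutation `w` has no descent except possibly at the 1-indexed position `j`. -/
def DescentOnlyAt {n : ℕ} (w : Equiv.Perm (Fin n)) (j : ℕ) : Prop :=
  ∀ l (h : l + 1 < n), w ⟨l + 1, h⟩ < w ⟨l, Nat.lt_of_succ_lt h⟩ → l + 1 = j

theorem DescentOnlyAt.lt_succ {n : ℕ} {w : Equiv.Perm (Fin n)} {j : ℕ} (hw : DescentOnlyAt w j)
    {l : ℕ} (h : l + 1 < n) (hl : l + 1 ≠ j) :
    (w ⟨l, Nat.lt_of_succ_lt h⟩ : ℕ) < w ⟨l + 1, h⟩ := by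
  refine lt_of_le_of_ne (not_lt.1 fun h' => hl (hw l h h')) fun h' => ?_
  have := w.injective (Fin.ext h')
  simp at this

theorem DescentOnlyAt.lt_of_lt {n : ℕ} {w : Equiv.Perm (Fin n)} {j : ℕ} (hw : DescentOnlyAt w j)
    {c : ℕ → ℕ → ℤ} (hc : IsCorner n c) {k l : ℕ} (hk : k ≤ n) (hl : l ≤ n)
    (hlt : cornerSum (permMat w) k l < c k l) : cornerSum (permMat w) k j < c k j := by
  have hd := (isASM_permMat w).isCorner
  have right : ∀ l, (hl : l ≤ n) → cornerSum (permMat w) k l < c k l →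
      (∀ h : l < n, k ≤ w ⟨l, h⟩) → cornerSum (permMat w) k j < c k j := by
    intro l hl
    induction hl using Nat.decreasingInduction with
    | self =>
      intro h1
      rw [hd.top_right k hk, hc.top_right k hk] at h1
      exact absurd h1 (lt_irrefl _)
    | of_succ l hl ih =>
      intro h1 h2
      have h3 : cornerSum (permMat w) k (l + 1) < c k (l + 1) := by
        rw [cornerSum_permMat_succ_right w hl, if_neg (not_lt.2 (h2 hl)), add_zero]
        exact h1.trans_le (hc.mono_right k hk l hl)
      by_cases hj : l + 1 = j
      · rwa [← hj]
      · exact ih h3 fun h => (h2 hl).trans (hw.lt_succ h hj).le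
  have left : ∀ l, (hl : l < n) → cornerSum (permMat w) k (l + 1) < c k (l + 1) →
      (w ⟨l, hl⟩ : ℕ) < k → cornerSum (permMat w) k j < c k j := by
    intro l
    induction l with
    | zero =>
      intro hl h1 h2
      rw [cornerSum_permMat_succ_right w hl, if_pos h2, hd.zero_right k hk] at h1
      have := hc.succ_right k hk 0 hl
      rw [hc.zero_right k hk] at this
      omega
    | succ l ih =>
      intro hl h1 h2
      have h3 : cornerSum (permMat w) k (l + 1) < c k (l + 1) := by
        rw [cornerSum_permMat_succ_right w hl, if_pos h2] at h1
        have := hc.succ_right k hk (l + 1) hl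
        omega
      by_cases hj : l + 1 = j
      · rwa [← hj]
      · exact ih (by omega) h3 ((hw.lt_succ hl hj).trans h2)
  by_cases hr : ∀ h : l < n, k ≤ w ⟨l, h⟩
  · exact right l hl hlt hr
  push Not at hr
  obtain ⟨h, hr⟩ := hr
  by_cases hj : l = j
  · rwa [← hj]
  rcases l with - | l
  · rw [hd.zero_right k hk, hc.zero_right k hk] at hlt
    exact absurd hlt (lt_irrefl _)
  · exact left l (by omega) hlt ((hw.lt_succ h hj).trans hr)

/-- A permutation with at most one descent, at `j`, whose inverse has at most one descent, at
`i`, has the greatest corner sums among those whose value at `(i, j)` is at most its own. -/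
theorem le_cornerSum_permMat {n : ℕ} {w : Equiv.Perm (Fin n)} {i j : ℕ}
    (hj : DescentOnlyAt w j) (hi : DescentOnlyAt w⁻¹ i) (hjn : j ≤ n)
    {c : ℕ → ℕ → ℤ} (hc : IsCorner n c) (hle : c i j ≤ cornerSum (permMat w) i j) {k l : ℕ}
    (hk : k ≤ n) (hl : l ≤ n) : c k l ≤ cornerSum (permMat w) k l := by
  by_contra! hlt
  have h1 := hj.lt_of_lt hc hk hl hlt
  have h2 := hi.lt_of_lt (k := j) (l := k) hc.swap hjn hk (by
    rwa [permMat_inv, cornerSum_transpose])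
  rw [permMat_inv, cornerSum_transpose] at h2
  exact absurd h2 (not_lt.2 hle)

/-! ### Bigrassmannian permutations -/

theorem mem_descents {n : ℕ} {w : Equiv.Perm (Fin n)} {l : ℕ} :
    l ∈ descents w ↔ ∃ h : l + 1 < n, w ⟨l + 1, h⟩ < w ⟨l, Nat.lt_of_succ_lt h⟩ := by
  simp only [descents, mem_filter, mem_range]
  constructor
  · rintro ⟨h1, h2⟩
    exact ⟨by omega, h2 _⟩
  · rintro ⟨h1, h2⟩
    exact ⟨by omega, fun _ => h2⟩

theorem exists_descentOnlyAt {n : ℕ} {w : Equiv.Perm (Fin n)} (h : (descents w).card = 1) :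
    ∃ j ≤ n, DescentOnlyAt w j := by
  obtain ⟨a, ha⟩ := card_eq_one.1 h
  obtain ⟨h1, -⟩ := mem_descents.1 (ha ▸ mem_singleton_self a)
  refine ⟨a + 1, by omega, fun l hl hlt => ?_⟩
  have := mem_descents.2 ⟨hl, hlt⟩
  rw [ha, mem_singleton] at this
  rw [this]

theorem not_bigrassmannian_one {n : ℕ} : ¬ Bigrassmannian (1 : Equiv.Perm (Fin n)) := by
  rintro ⟨h, -⟩
  obtain ⟨a, ha⟩ := card_eq_one.1 h
  obtain ⟨h1, h2⟩ := mem_descents.1 (ha ▸ mem_singleton_self a)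
  simp [Fin.lt_def] at h2

theorem asmLe_permMat_one {n : ℕ} {A : Matrix (Fin n) (Fin n) ℤ} (hA : IsASM A) :
    asmLe (permMat 1) A := by
  have h : DescentOnlyAt (1 : Equiv.Perm (Fin n)) 0 := fun l hl hlt => by
    simp [Fin.lt_def] at hlt
  rw [asmLe_iff]
  intro k hk l hl
  exact le_cornerSum_permMat h (by rwa [inv_one]) (Nat.zero_le n) hA.isCorner (by simp) hk hl

theorem Bigrassmannian.exists_corner {n : ℕ} {w : Equiv.Perm (Fin n)} (hw : Bigrassmannian w) :
    ∃ i ≤ n, ∃ j ≤ n, ∀ c, IsCorner n c → c i j ≤ cornerSum (permMat w) i j →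
      ∀ k ≤ n, ∀ l ≤ n, c k l ≤ cornerSum (permMat w) k l := by
  obtain ⟨j, hjn, hj⟩ := exists_descentOnlyAt hw.1
  obtain ⟨i, hin, hi⟩ := exists_descentOnlyAt hw.2
  exact ⟨i, hin, j, hjn, fun c hc h k hk l hl => le_cornerSum_permMat hj hi hjn hc h hk hl⟩

/-- The one-line word `1, …, r, i + 1, …, i + j - r, r + 1, …, i, i + j - r + 1, …` (0-indexed). -/
def blockSwapFun (i j r l : ℕ) : ℕ :=
  if l < r then l else if l < j then l + (i - r) else if l < i + j - r then l - (j - r) else l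

theorem blockSwapFun_lt {n i j r l : ℕ} (hi : r < i) (hj : r < j) (hn : i + j ≤ r + n)
    (hl : l < n) : blockSwapFun i j r l < n := by
  unfold blockSwapFun
  split_ifs <;> omega

theorem blockSwapFun_blockSwapFun {i j r : ℕ} (hi : r < i) (hj : r < j) (l : ℕ) :
    blockSwapFun j i r (blockSwapFun i j r l) = l := by
  unfold blockSwapFun
  split_ifs <;> omega

/-- The permutation exchanging the two adjacent blocks `r + 1, …, i` and `i + 1, …, i + j - r`. -/
def blockSwap (n i j r : ℕ) (hi : r < i) (hj : r < j) (hn : i + j ≤ r + n) :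
    Equiv.Perm (Fin n) where
  toFun l := ⟨blockSwapFun i j r l, blockSwapFun_lt hi hj hn l.2⟩
  invFun l := ⟨blockSwapFun j i r l, blockSwapFun_lt hj hi (by omega) l.2⟩
  left_inv l := Fin.ext (blockSwapFun_blockSwapFun hi hj l)
  right_inv l := Fin.ext (blockSwapFun_blockSwapFun hj hi l)

theorem descents_blockSwap {n i j r : ℕ} (hi : r < i) (hj : r < j) (hn : i + j ≤ r + n) :
    descents (blockSwap n i j r hi hj hn) = {j - 1} := by
  ext l
  rw [mem_descents, mem_singleton]
  simp only [blockSwap, Equiv.coe_fn_mk, Fin.mk_lt_mk, exists_prop, blockSwapFun]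
  constructor
  · rintro ⟨h1, h2⟩
    split_ifs at h2 <;> omega
  · rintro rfl
    refine ⟨by omega, ?_⟩
    split_ifs <;> omega

theorem bigrassmannian_blockSwap {n i j r : ℕ} (hi : r < i) (hj : r < j) (hn : i + j ≤ r + n) :
    Bigrassmannian (blockSwap n i j r hi hj hn) := by
  have hinv : (blockSwap n i j r hi hj hn)⁻¹ = blockSwap n j i r hj hi (by omega) := rfl
  rw [Bigrassmannian, hinv, descents_blockSwap, descents_blockSwap]
  simp

theorem descentOnlyAt_blockSwap {n i j r : ℕ} (hi : r < i) (hj : r < j) (hn : i + j ≤ r + n) :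
    DescentOnlyAt (blockSwap n i j r hi hj hn) j := by
  intro l h1 h2
  have := mem_descents.2 ⟨h1, h2⟩
  rw [descents_blockSwap, mem_singleton] at this
  omega

theorem cornerSum_blockSwap {n i j r : ℕ} (hi : r < i) (hj : r < j) (hn : i + j ≤ r + n) :
    cornerSum (permMat (blockSwap n i j r hi hj hn)) i j = r := by
  have key : ∀ m ≤ j, cornerSum (permMat (blockSwap n i j r hi hj hn)) i m
      = if m < r then (m : ℤ) else r := by
    intro m
    induction m with
    | zero => intro _; simp; omega
    | succ m ih =>
      intro hm
      rw [cornerSum_permMat_succ_right _ (show m < n by omega), ih (by omega)]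
      simp only [blockSwap, Equiv.coe_fn_mk, blockSwapFun]
      split_ifs <;> push_cast <;> omega
  rw [key j le_rfl, if_neg (by omega)]

theorem exists_bigrassmannian {n i j r : ℕ} (hi : r < i) (hj : r < j) (hn : i + j ≤ r + n) :
    ∃ w : Equiv.Perm (Fin n), Bigrassmannian w ∧ cornerSum (permMat w) i j = r ∧
      ∀ c, IsCorner n c → c i j ≤ r → ∀ k ≤ n, ∀ l ≤ n, c k l ≤ cornerSum (permMat w) k l := by
  refine ⟨blockSwap n i j r hi hj hn, bigrassmannian_blockSwap hi hj hn,
    cornerSum_blockSwap hi hj hn, fun c hc hle k hk l hl => ?_⟩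
  refine le_cornerSum_permMat (descentOnlyAt_blockSwap hi hj hn)
    (descentOnlyAt_blockSwap hj hi (by omega)) (by omega) hc ?_ hk hl
  rwa [cornerSum_blockSwap]

/-! ### The isomorphism -/

/-- The bigrassmannian permutations whose matrices lie below `A`. -/
def bigrassmannianBelow {n : ℕ} (A : Matrix (Fin n) (Fin n) ℤ) : Set (Equiv.Perm (Fin n)) :=
  {w | Bigrassmannian w ∧ asmLe (permMat w) A}

theorem isLowerSetBG_bigrassmannianBelow {n : ℕ} (A : Matrix (Fin n) (Fin n) ℤ) :
    IsLowerSetBG n (bigrassmannianBelow A) :=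
  ⟨fun _ hw => hw.1, fun _ _ hx hy hxy => ⟨hx, fun k l => (hy.2 k l).trans (hxy k l)⟩⟩

theorem bigrassmannianBelow_subset_iff {n : ℕ} {A B : Matrix (Fin n) (Fin n) ℤ}
    (hA : IsASM A) (hB : IsASM B) :
    bigrassmannianBelow A ⊆ bigrassmannianBelow B ↔ asmLe A B := by
  refine ⟨fun h => ?_, fun h w hw => ⟨hw.1, fun k l => (h k l).trans (hw.2 k l)⟩⟩
  rw [asmLe_iff]
  intro k hk l hl
  by_contra! hlt
  obtain ⟨r, hr⟩ := Int.eq_ofNat_of_zero_le (hA.isCorner.nonneg hk hl)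
  have h1 := hB.isCorner.le_left hk hl
  have h2 := hB.isCorner.le_right hk hl
  have h3 := hA.isCorner.add_le hk hl
  obtain ⟨w, hw, hwr, hwc⟩ := exists_bigrassmannian (n := n) (i := k) (j := l) (r := r)
    (by omega) (by omega) (by omega)
  have hwB := h ⟨hw, (asmLe_iff _ _).2 (hwc _ hA.isCorner hr.le)⟩
  have := (asmLe_iff _ _).1 hwB.2 k hk l hl
  omega

theorem exists_bigrassmannianBelow_eq {n : ℕ} {U : Set (Equiv.Perm (Fin n))}
    (hU : IsLowerSetBG n U) : ∃ A, IsASM A ∧ bigrassmannianBelow A = U := by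
  classical
  have hs : (insert 1 U.toFinset).Nonempty := insert_nonempty _ _
  obtain ⟨A, hA, hAc⟩ := (IsCorner.inf' hs (c := fun w => cornerSum (permMat w))
    fun w _ => (isASM_permMat w).isCorner).exists_isASM
  refine ⟨A, hA, Set.Subset.antisymm (fun w hw => ?_) fun w hw => ⟨hU.1 w hw, ?_⟩⟩
  · obtain ⟨i, hi, j, hj, hij⟩ := hw.1.exists_corner
    obtain ⟨x, hx, hx'⟩ := (insert 1 U.toFinset).exists_mem_eq_inf' hs
      fun w => cornerSum (permMat w) i j
    have hle := (asmLe_iff _ _).1 hw.2 i hi j hj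
    rw [hAc i hi j hj, hx'] at hle
    have hwx : asmLe (permMat w) (permMat x) :=
      (asmLe_iff _ _).2 (hij _ (isASM_permMat x).isCorner hle)
    rcases mem_insert.1 hx with rfl | hx
    · have h1w : asmLe (permMat 1) (permMat w) := asmLe_permMat_one (isASM_permMat w)
      have := permMat_injective (eq_of_asmLe_of_asmLe h1w hwx)
      exact absurd (this ▸ hw.1) not_bigrassmannian_one
    · exact hU.2 w x hw.1 (by simpa using hx) hwx
  · rw [asmLe_iff]
    intro k hk l hl
    rw [hAc k hk l hl]
    exact inf'_le _ (by simp [hw])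

end ASMPaper

open ASMPaper in
/-- For `n ≥ 2`, the lattice of lower sets of the poset of bigrassmannian permutations
under the Bruhat order, ordered by inclusion, is order-isomorphic to the lattice
`ASM_n`; the isomorphism can be chosen so that the principal lower set generated by a
bigrassmannian permutation `w` is sent to the permutation matrix `[w]`. -/
theorem lowerSets_bigrassmannian_iso_asm (n : ℕ) (hn : 2 ≤ n) :
    ∃ F : {U : Set (Equiv.Perm (Fin n)) // IsLowerSetBG n U} →
          {A : Matrix (Fin n) (Fin n) ℤ // IsASM A},
      Function.Bijective F ∧
      (∀ U V : {U : Set (Equiv.Perm (Fin n)) // IsLowerSetBG n U},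
        U.1 ⊆ V.1 ↔ asmLe (F U).1 (F V).1) ∧
      (∀ w : Equiv.Perm (Fin n), Bigrassmannian w →
        ∀ U : {U : Set (Equiv.Perm (Fin n)) // IsLowerSetBG n U},
          U.1 = {x | Bigrassmannian x ∧ bruhatLe x w} → (F U).1 = permMat w) := by
  classical
  let G : {A : Matrix (Fin n) (Fin n) ℤ // IsASM A} →
      {U : Set (Equiv.Perm (Fin n)) // IsLowerSetBG n U} := fun A =>
    ⟨bigrassmannianBelow A.1, isLowerSetBG_bigrassmannianBelow A.1⟩
  have hG : Function.Bijective G := by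
    constructor
    · intro A B hAB
      have h : bigrassmannianBelow A.1 = bigrassmannianBelow B.1 := congrArg Subtype.val hAB
      exact Subtype.ext (eq_of_asmLe_of_asmLe
        ((bigrassmannianBelow_subset_iff A.2 B.2).1 h.subset)
        ((bigrassmannianBelow_subset_iff B.2 A.2).1 h.superset))
    · rintro ⟨U, hU⟩
      obtain ⟨A, hA, hAU⟩ := exists_bigrassmannianBelow_eq hU
      exact ⟨⟨A, hA⟩, Subtype.ext hAU⟩
  let e := Equiv.ofBijective G hG
  refine ⟨e.symm, e.symm.bijective, fun U V => ?_, fun w _ U hwU => ?_⟩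
  · rw [← bigrassmannianBelow_subset_iff (e.symm U).2 (e.symm V).2]
    have hU : bigrassmannianBelow (e.symm U).1 = U.1 := congrArg Subtype.val (e.apply_symm_apply U)
    have hV : bigrassmannianBelow (e.symm V).1 = V.1 := congrArg Subtype.val (e.apply_symm_apply V)
    rw [hU, hV]
  · have : e.symm U = ⟨permMat w, isASM_permMat w⟩ := by
      rw [Equiv.symm_apply_eq]
      exact Subtype.ext hwU
    rw [this]
end

section
/- Let U be a nonempty set of permutations of {1,…,n}. Then there is a unique n×n alternating sign matrix A(U) whose partial-sum matrix is given by C(A(U))_{kl} = min_{x∈U} Σ_{i≤k, j≤l} [x]_{ij} for all 1 ≤ k,l ≤ n, and A(U) is the least upper bound in the lattice ASM_n of the set of permutation matrices {[x] : x ∈ U}. -/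
namespace ASMPaper

open Finset

lemma sum_fin_Iic {n : ℕ} (f : ℕ → ℤ) (k : Fin n) :
    ∑ i ∈ Iic k, f i = ∑ i ∈ range (k + 1), f i := by
  rw [Nat.range_succ_eq_Iic, ← Fin.map_valEmbedding_Iic, sum_map]
  rfl

lemma eq_of_sum_Iic_eq {n : ℕ} {f g : Fin n → ℤ}
    (h : ∀ k, ∑ i ∈ Iic k, f i = ∑ i ∈ Iic k, g i) : f = g := by
  funext k
  induction k using WellFoundedLT.induction with
  | ind k ih =>
    have hk := h k
    rw [← Iio_insert, sum_insert (by simp), sum_insert (by simp),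
      sum_congr rfl fun i hi => ih i (mem_Iio.mp hi)] at hk
    exact add_right_cancel hk

lemma Csum_injective {n : ℕ} {A B : Matrix (Fin n) (Fin n) ℤ}
    (h : ∀ k l, Csum A k l = Csum B k l) : A = B := by
  have rows : ∀ l, (fun i => ∑ j ∈ Iic l, A i j) = fun i => ∑ j ∈ Iic l, B i j :=
    fun l => eq_of_sum_Iic_eq fun k => h k l
  ext i j
  exact congrFun (eq_of_sum_Iic_eq fun l => congrFun (rows l) i) j

lemma alternating_diff {n : ℕ} (s : ℕ → ℤ) (hs : ∀ m ≤ n, s m = 0 ∨ s m = 1) :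
    Alternating (fun j : Fin n => s (j + 1) - s j) := by
  intro a b hab ha hb hz
  have const : ∀ m, (a : ℕ) + 1 ≤ m → m ≤ b → s m = s (a + 1) := by
    intro m hm
    induction m, hm using Nat.le_induction with
    | base => simp
    | succ m hm ih =>
      intro hmb
      have hzero := hz ⟨m, by omega⟩ (Fin.lt_def.mpr hm) (Fin.lt_def.mpr hmb)
      simp only at hzero
      have := ih (by omega)
      omega
  have hab' : (a : ℕ) < b := hab
  have heq := const b hab' le_rfl
  have h₁ := hs a (by omega)
  have h₂ := hs (a + 1) (by omega)
  have h₃ := hs (b + 1) (by omega)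
  simp only at ha hb ⊢
  omega

/-- The properties characterizing the partial sums of an alternating sign matrix, indexed so
that `M k l` is the sum over the first `k` rows and the first `l` columns. -/
structure IsCornerSum (n : ℕ) (M : ℕ → ℕ → ℤ) : Prop where
  zero_left : ∀ l, M 0 l = 0
  zero_right : ∀ k, M k 0 = 0
  full_left : ∀ l ≤ n, M n l = l
  full_right : ∀ k ≤ n, M k n = k
  step_left : ∀ k l, M k l ≤ M (k + 1) l ∧ M (k + 1) l ≤ M k l + 1
  step_right : ∀ k l, M k l ≤ M k (l + 1) ∧ M k (l + 1) ≤ M k l + 1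

/-- The matrix of mixed second differences of `M`. -/
def diffMat (n : ℕ) (M : ℕ → ℕ → ℤ) : Matrix (Fin n) (Fin n) ℤ :=
  Matrix.of fun i j => (M (i + 1) (j + 1) - M i (j + 1)) - (M (i + 1) j - M i j)

lemma IsCornerSum.isASM_diffMat {n : ℕ} {M : ℕ → ℕ → ℤ} (hM : IsCornerSum n M) :
    IsASM (diffMat n M) := by
  refine ⟨fun i j => ?_, fun i => ?_, fun j => ?_, fun i => ?_, fun j => ?_⟩
  · have h₁ := hM.step_left i (j + 1)
    have h₂ := hM.step_left i j
    simp only [diffMat, Matrix.of_apply]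
    omega
  · have h := Fin.sum_univ_eq_sum_range
      (fun j => (M (i + 1) (j + 1) - M i (j + 1)) - (M (i + 1) j - M i j)) n
    rw [sum_range_sub (fun j => M (i + 1) j - M i j)] at h
    refine h.trans ?_
    rw [hM.zero_right, hM.zero_right, hM.full_right _ (by omega), hM.full_right _ (by omega)]
    push_cast
    ring
  · have h := Fin.sum_univ_eq_sum_range
      (fun i => (M (i + 1) (j + 1) - M (i + 1) j) - (M i (j + 1) - M i j)) n
    rw [sum_range_sub (fun i => M i (j + 1) - M i j)] at h
    refine (sum_congr rfl fun i _ => ?_).trans (h.trans ?_)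
    · simp only [diffMat, Matrix.of_apply]
      ring
    · rw [hM.zero_left, hM.zero_left, hM.full_left _ (by omega), hM.full_left _ (by omega)]
      push_cast
      ring
  · refine alternating_diff (fun j => M (i + 1) j - M i j) fun m _ => ?_
    have := hM.step_left i m
    omega
  · have h := alternating_diff (n := n) (fun i => M i (j + 1) - M i j) fun m _ => by
      have := hM.step_right m j
      omega
    convert h using 2 with i
    simp only [diffMat, Matrix.of_apply]
    ring

lemma IsCornerSum.Csum_diffMat {n : ℕ} {M : ℕ → ℕ → ℤ} (hM : IsCornerSum n M) (k l : Fin n) :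
    Csum (diffMat n M) k l = M (k + 1) (l + 1) := by
  have row : ∀ i : Fin n, ∑ j ∈ Iic l, diffMat n M i j =
      M (i + 1) (l + 1) - M i (l + 1) := fun i => by
    refine (sum_fin_Iic (fun j => (M (i + 1) (j + 1) - M i (j + 1)) - (M (i + 1) j - M i j))
      l).trans ?_
    rw [sum_range_sub (fun j => M (i + 1) j - M i j), hM.zero_right, hM.zero_right]
    ring
  rw [Csum, sum_congr rfl fun i _ => row i,
    sum_fin_Iic (fun i => M (i + 1) (l + 1) - M i (l + 1)), sum_range_sub (fun i => M i (l + 1)),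
    hM.zero_left, sub_zero]

/-- The number of nonzero entries of the permutation matrix of `x` in its first `k` rows and
first `l` columns. -/
def permCorner {n : ℕ} (x : Equiv.Perm (Fin n)) (k l : ℕ) : ℤ :=
  #{j : Fin n | (j : ℕ) < l ∧ (x j : ℕ) < k}

lemma Csum_permMat {n : ℕ} (x : Equiv.Perm (Fin n)) (k l : Fin n) :
    Csum (permMat x) k l = permCorner x (k + 1) (l + 1) := by
  simp only [Csum, permMat, Matrix.of_apply]
  rw [sum_comm, permCorner, card_filter, Nat.cast_sum]
  simp only [sum_ite_eq, mem_Iic, Fin.le_def, Nat.lt_succ_iff]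
  have hl : Iic l = univ.filter fun j : Fin n => (j : ℕ) ≤ l := by ext; simp
  rw [hl, sum_filter]
  simp only [ite_and, Nat.cast_ite, Nat.cast_one, Nat.cast_zero]

lemma card_filter_val_lt {n k : ℕ} (hk : k ≤ n) : #{j : Fin n | (j : ℕ) < k} = k := by
  simp [Fin.card_filter_val_lt, hk]

lemma card_le_card_add_one {α : Type*} [DecidableEq α] {s t u : Finset α} (h : t ⊆ s ∪ u)
    (hu : #u ≤ 1) : #t ≤ #s + 1 :=
  (card_le_card h).trans ((card_union_le s u).trans (by omega))

lemma isCornerSum_permCorner {n : ℕ} (x : Equiv.Perm (Fin n)) :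
    IsCornerSum n (permCorner x) where
  zero_left l := by simp [permCorner]
  zero_right k := by simp [permCorner]
  full_left l hl := by simp [permCorner, card_filter_val_lt hl]
  full_right k hk := by
    have h : #{j : Fin n | (x j : ℕ) < k} = #{j : Fin n | (j : ℕ) < k} :=
      card_equiv x (by simp)
    simp [permCorner, h, card_filter_val_lt hk]
  step_left k l := by
    refine ⟨?_, ?_⟩
    · refine Nat.cast_le.mpr (card_le_card fun j hj => ?_)
      simp only [mem_filter, mem_univ, true_and] at hj ⊢
      omega
    · have h : #{j : Fin n | (x j : ℕ) = k} ≤ 1 := card_le_one.mpr fun a ha b hb =>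
        x.injective (Fin.ext (by simp_all))
      unfold permCorner
      norm_cast
      refine card_le_card_add_one (fun j hj => ?_) h
      simp only [mem_union, mem_filter, mem_univ, true_and] at hj ⊢
      omega
  step_right k l := by
    refine ⟨?_, ?_⟩
    · refine Nat.cast_le.mpr (card_le_card fun j hj => ?_)
      simp only [mem_filter, mem_univ, true_and] at hj ⊢
      omega
    · have h : #{j : Fin n | (j : ℕ) = l} ≤ 1 := card_le_one.mpr fun a ha b hb =>
        Fin.ext (by simp_all)
      unfold permCorner
      norm_cast
      refine card_le_card_add_one (fun j hj => ?_) h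
      simp only [mem_union, mem_filter, mem_univ, true_and] at hj ⊢
      omega

lemma IsCornerSum.of_min {n : ℕ} {ι : Type*} {P : ι → ℕ → ℕ → ℤ}
    (hP : ∀ x, IsCornerSum n (P x)) {U : Set ι} {M : ℕ → ℕ → ℤ}
    (mem : ∀ k l, ∃ x ∈ U, M k l = P x k l) (le : ∀ x ∈ U, ∀ k l, M k l ≤ P x k l) :
    IsCornerSum n M where
  zero_left l := by
    obtain ⟨x, -, h⟩ := mem 0 l
    rw [h, (hP x).zero_left]
  zero_right k := by
    obtain ⟨x, -, h⟩ := mem k 0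
    rw [h, (hP x).zero_right]
  full_left l hl := by
    obtain ⟨x, -, h⟩ := mem n l
    rw [h, (hP x).full_left l hl]
  full_right k hk := by
    obtain ⟨x, -, h⟩ := mem k n
    rw [h, (hP x).full_right k hk]
  step_left k l := by
    obtain ⟨x, hx, h⟩ := mem k l
    obtain ⟨y, hy, h'⟩ := mem (k + 1) l
    have := le x hx (k + 1) l
    have := le y hy k l
    have := (hP x).step_left k l
    have := (hP y).step_left k l
    omega
  step_right k l := by
    obtain ⟨x, hx, h⟩ := mem k l
    obtain ⟨y, hy, h'⟩ := mem k (l + 1)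
    have := le x hx k (l + 1)
    have := le y hy k l
    have := (hP x).step_right k l
    have := (hP y).step_right k l
    omega

lemma bddBelow_values {ι : Type*} [Finite ι] (U : Set ι) (f : ι → ℤ) :
    BddBelow {z : ℤ | ∃ x ∈ U, z = f x} :=
  ((Set.finite_range f).subset (by rintro _ ⟨x, -, rfl⟩; exact ⟨x, rfl⟩)).bddBelow

lemma nonempty_values {ι : Type*} {U : Set ι} (hU : U.Nonempty) (f : ι → ℤ) :
    {z : ℤ | ∃ x ∈ U, z = f x}.Nonempty :=
  hU.imp' f fun x hx => ⟨x, hx, rfl⟩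

lemma exists_isASM_Csum_eq_sInf {n : ℕ} {U : Set (Equiv.Perm (Fin n))} (hU : U.Nonempty) :
    ∃ A : Matrix (Fin n) (Fin n) ℤ, IsASM A ∧
      ∀ k l, Csum A k l = sInf {z : ℤ | ∃ x ∈ U, z = Csum (permMat x) k l} := by
  have hM : IsCornerSum n fun k l => sInf {z : ℤ | ∃ x ∈ U, z = permCorner x k l} :=
    .of_min isCornerSum_permCorner
      (fun _ _ => Int.csInf_mem (nonempty_values hU _) (bddBelow_values U _))
      (fun x hx _ _ => csInf_le (bddBelow_values U _) ⟨x, hx, rfl⟩)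
  exact ⟨_, hM.isASM_diffMat, fun k l => by simp only [hM.Csum_diffMat, Csum_permMat]⟩

end ASMPaper

open ASMPaper in
/-- For a nonempty set `U` of permutations of `{1, …, n}`, there is a unique alternating
sign matrix `A(U)` whose partial-sum matrix is the entrywise minimum of the partial-sum
matrices of the permutation matrices `[x]`, `x ∈ U`, and `A(U)` is the least upper bound
in `ASM_n` of the set of permutation matrices `{[x] : x ∈ U}`. -/
theorem join_of_permutations (n : ℕ) (hn : 1 ≤ n)
    (U : Set (Equiv.Perm (Fin n))) (hU : U.Nonempty) :
    (∃! A : Matrix (Fin n) (Fin n) ℤ, IsASM A ∧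
      ∀ k l, Csum A k l = sInf {z : ℤ | ∃ x ∈ U, z = Csum (permMat x) k l}) ∧
    (∀ A : Matrix (Fin n) (Fin n) ℤ, IsASM A →
      (∀ k l, Csum A k l = sInf {z : ℤ | ∃ x ∈ U, z = Csum (permMat x) k l}) →
      (∀ x ∈ U, asmLe (permMat x) A) ∧
        ∀ B : Matrix (Fin n) (Fin n) ℤ, IsASM B →
          (∀ x ∈ U, asmLe (permMat x) B) → asmLe A B) := by
  obtain ⟨A, hA, hAC⟩ := exists_isASM_Csum_eq_sInf hU
  refine ⟨⟨A, ⟨hA, hAC⟩, fun B hB => Csum_injective fun k l => ?_⟩, fun A _ hAC => ⟨?_, ?_⟩⟩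
  · rw [hB.2, hAC]
  · intro x hx k l
    rw [hAC]
    exact csInf_le (bddBelow_values U _) ⟨x, hx, rfl⟩
  · intro B _ hB k l
    rw [hAC]
    refine le_csInf (nonempty_values hU _) ?_
    rintro _ ⟨x, hx, rfl⟩
    exact hB x hx k l
end
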